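/- arXiv:2406.18273 — 10 statements merged into one kernel-verified Lean document; each statement's English description precedes it below -/
import Mathlib

section
/- Let A, B, G, j be natural numbers with j + 1 ≤ B, j + 1 ≤ G, and G ≤ A + j. Then choose(B, j+1)·choose(A, G−j−1) ≥ choose(B, j)·choose(A, G−j) if and only if (B−j)·(G−j) ≥ (j+1)·(A+j+1−G). -/
/-- Monotonicity criterion for `f(j) = choose B j * choose A (G - j)`:
given `j + 1 ≤ B`, `j + 1 ≤ G`, `G ≤ A + j`, one has
`choose B (j+1) * choose A (G-j-1) ≥ choose B j * choose A (G-j)` iff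
`(B-j)*(G-j) ≥ (j+1)*(A+j+1-G)`. -/
theorem stmt1 (A B G j : ℕ) (hB : j + 1 ≤ B) (hG : j + 1 ≤ G) (hA : G ≤ A + j) :
    Nat.choose B j * Nat.choose A (G - j) ≤ Nat.choose B (j + 1) * Nat.choose A (G - j - 1) ↔
      (j + 1) * (A + j + 1 - G) ≤ (B - j) * (G - j) := by
  obtain ⟨m, rfl⟩ := Nat.exists_eq_add_of_le hG
  have e1 : j + 1 + m - j = m + 1 := by omega
  have e2 : A + j + 1 - (j + 1 + m) = A - m := by omega
  rw [e1, e2, Nat.add_sub_cancel]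
  have h1 := Nat.choose_succ_right_eq B j
  have h2 := Nat.choose_succ_right_eq A m
  have hb : 0 < Nat.choose B j := Nat.choose_pos (by omega)
  have ha : 0 < Nat.choose A m := Nat.choose_pos (by omega)
  have hp : 0 < (j + 1) * (m + 1) := by positivity
  have hq : 0 < Nat.choose B j * Nat.choose A m := Nat.mul_pos hb ha
  have hl : (j + 1) * (m + 1) * (Nat.choose B j * Nat.choose A (m + 1)) =
      Nat.choose B j * Nat.choose A m * ((j + 1) * (A - m)) := by
    linear_combination (j + 1) * Nat.choose B j * h2
  have hr : (j + 1) * (m + 1) * (Nat.choose B (j + 1) * Nat.choose A m) =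
      Nat.choose B j * Nat.choose A m * ((B - j) * (m + 1)) := by
    linear_combination (m + 1) * Nat.choose A m * h1
  rw [← Nat.mul_le_mul_left_iff hp, hl, hr, Nat.mul_le_mul_left_iff hq]
end

section
/- Let A, B, G, j, δ be natural numbers with j + δ ≤ B, j + δ ≤ G, and G ≤ A + j. Then choose(B, j)·choose(A, G−j) ≤ (j+δ)^δ · (A+j+δ−G)^δ · choose(B, j+δ)·choose(A, G−j−δ). -/
theorem choose_shift_aux (B j δ : ℕ) (hB : j + δ ≤ B) :
    Nat.choose B j ≤ (j + δ) ^ δ * Nat.choose B (j + δ) := by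
  induction δ with
  | zero => simp
  | succ d ih =>
    have h1 := ih (by omega)
    have h2 := Nat.choose_succ_right_eq B (j + d)
    have h3 : Nat.choose B (j + d) ≤ (j + d + 1) * Nat.choose B (j + d + 1) := by
      have : 1 ≤ B - (j + d) := by omega
      nlinarith [Nat.zero_le (Nat.choose B (j + d))]
    calc Nat.choose B j ≤ (j + d) ^ d * Nat.choose B (j + d) := h1
      _ ≤ (j + d + 1) ^ d * ((j + d + 1) * Nat.choose B (j + d + 1)) := by
        exact Nat.mul_le_mul (Nat.pow_le_pow_left (by omega) d) h3
      _ = (j + (d + 1)) ^ (d + 1) * Nat.choose B (j + (d + 1)) := by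
        rw [← add_assoc]; ring

/-- Shifting the index of `f(j) = choose B j * choose A (G - j)` by `δ` changes its value
by at most a polynomial factor: for `j + δ ≤ B`, `j + δ ≤ G`, `G ≤ A + j`,
`choose B j * choose A (G-j) ≤ (j+δ)^δ * (A+j+δ-G)^δ * choose B (j+δ) * choose A (G-j-δ)`. -/
theorem stmt2 (A B G j δ : ℕ) (hB : j + δ ≤ B) (hG : j + δ ≤ G) (hA : G ≤ A + j) :
    Nat.choose B j * Nat.choose A (G - j) ≤
      (j + δ) ^ δ * (A + j + δ - G) ^ δ * Nat.choose B (j + δ) * Nat.choose A (G - j - δ) := by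
  have h1 := choose_shift_aux B j δ hB
  have h2 := choose_shift_aux A (A - (G - j)) δ (by omega)
  rw [Nat.choose_symm (by omega : G - j ≤ A)] at h2
  have e1 : A - (G - j) + δ = A + j + δ - G := by omega
  have e2 : A + j + δ - G = A - (G - j - δ) := by omega
  have h3 : Nat.choose A (A + j + δ - G) = Nat.choose A (G - j - δ) := by
    rw [e2, Nat.choose_symm (by omega : G - j - δ ≤ A)]
  rw [e1, h3] at h2
  calc _ ≤ _ := Nat.mul_le_mul h1 h2
    _ = _ := by ring
end

section
/- Define g(ρ) = (1−ρ)·h(ρ/(1−ρ)) − ρ·h(1/3) − (1−ρ)·h((2ρ/3)/(1−ρ)) for ρ ∈ (0, 1/2). There exist ξ > 0 and C > 0 such that for all ρ ∈ (0, ξ): |g(ρ) − (ρ·log₂(1/ρ))/3| ≤ C·ρ; in particular, there exists ξ′ > 0 such that g(ρ) > 0 for all ρ ∈ (0, ξ′). -/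
/-- The binary entropy function `h(x) = -x·log₂ x - (1-x)·log₂(1-x)`
(with the convention `log₂ 0 = 0`, so `h 0 = h 1 = 0`). -/
noncomputable def binH (x : ℝ) : ℝ :=
  -x * Real.logb 2 x - (1 - x) * Real.logb 2 (1 - x)

/-- `g(ρ) = (1-ρ)·h(ρ/(1-ρ)) - ρ·h(1/3) - (1-ρ)·h((2ρ/3)/(1-ρ))`. -/
noncomputable def gFun (ρ : ℝ) : ℝ :=
  (1 - ρ) * binH (ρ / (1 - ρ)) - ρ * binH (1 / 3) - (1 - ρ) * binH ((2 * ρ / 3) / (1 - ρ))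

theorem scaled_binH (q a : ℝ) (hq : 0 < q) (ha : 0 < a) (haq : a < q) :
    q * binH (a / q) =
      (-a * Real.log a - (q - a) * Real.log (q - a) + q * Real.log q) / Real.log 2 := by
  have h1 : 1 - a / q = (q - a) / q := by field_simp
  have h2 : Real.log 2 ≠ 0 := (Real.log_pos (by norm_num)).ne'
  unfold binH
  rw [h1]
  unfold Real.logb
  rw [Real.log_div ha.ne' hq.ne', Real.log_div (sub_pos.2 haq).ne' hq.ne']
  field_simp
  ring

theorem mul_log_bounds (y : ℝ) (hy : 0 < y) (hy1 : y ≤ 1) :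
    y - 1 ≤ y * Real.log y ∧ y * Real.log y ≤ 0 := by
  constructor
  · have h := Real.one_sub_inv_le_log_of_pos hy
    have h2 := mul_le_mul_of_nonneg_left h hy.le
    rwa [mul_sub, mul_inv_cancel₀ hy.ne', mul_one] at h2
  · exact mul_nonpos_of_nonneg_of_nonpos hy.le (Real.log_nonpos hy.le hy1)

theorem main_bound : ∃ C : ℝ, 0 < C ∧ ∀ ρ : ℝ, 0 < ρ → ρ < 1 / 2 →
      |gFun ρ - ρ * Real.logb 2 (1 / ρ) / 3| ≤ C * ρ := by
  have hl : 0 < Real.log 2 := Real.log_pos (by norm_num)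
  refine ⟨|2 / 3 * Real.log (2 / 3) / Real.log 2 - binH (1 / 3)| + 4 / Real.log 2,
    by positivity, ?_⟩
  intro ρ h0 h1
  have e1 := scaled_binH (1 - ρ) ρ (by linarith) h0 (by linarith)
  have e2 := scaled_binH (1 - ρ) (2 * ρ / 3) (by linarith) (by linarith) (by linarith)
  have r1 : 1 - ρ - ρ = 1 - 2 * ρ := by ring
  have r2 : 1 - ρ - 2 * ρ / 3 = 1 - 5 * ρ / 3 := by ring
  have r3 : Real.log (2 * ρ / 3) = Real.log (2 / 3) + Real.log ρ := by
    rw [← Real.log_mul (by norm_num) h0.ne']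
    congr 1
    ring
  rw [r1] at e1
  rw [r2, r3] at e2
  obtain ⟨b1, b2⟩ := mul_log_bounds (1 - 2 * ρ) (by linarith) (by linarith)
  obtain ⟨b3, b4⟩ := mul_log_bounds (1 - 5 * ρ / 3) (by linarith) (by linarith)
  set A := (1 - 2 * ρ) * Real.log (1 - 2 * ρ) with hA
  set B := (1 - 5 * ρ / 3) * Real.log (1 - 5 * ρ / 3) with hB
  have key : gFun ρ - ρ * Real.logb 2 (1 / ρ) / 3 =
      (2 / 3 * Real.log (2 / 3) / Real.log 2 - binH (1 / 3)) * ρ + (B - A) / Real.log 2 := by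
    unfold gFun
    rw [e1, e2]
    unfold Real.logb
    rw [one_div ρ, Real.log_inv]
    field_simp
    ring
  rw [key, add_mul]
  refine (abs_add_le _ _).trans (add_le_add ?_ ?_)
  · rw [abs_mul, abs_of_pos h0]
  · rw [abs_div, abs_of_pos hl, div_mul_eq_mul_div]
    gcongr
    rw [abs_le]
    constructor <;> linarith

/-- `g(ρ) = (ρ·log₂(1/ρ))/3 + O(ρ)` as `ρ → 0⁺`; in particular `g(ρ) > 0` for all
sufficiently small `ρ > 0`. -/
theorem stmt8 :
    (∃ ξ C : ℝ, 0 < ξ ∧ 0 < C ∧ ∀ ρ : ℝ, 0 < ρ → ρ < ξ →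
      |gFun ρ - ρ * Real.logb 2 (1 / ρ) / 3| ≤ C * ρ) ∧
    (∃ ξ' : ℝ, 0 < ξ' ∧ ∀ ρ : ℝ, 0 < ρ → ρ < ξ' → 0 < gFun ρ) := by
  obtain ⟨C, hC, h⟩ := main_bound
  refine ⟨⟨1 / 2, C, by norm_num, hC, h⟩, min (1 / 2) ((2 : ℝ) ^ (-(3 * C))), by positivity, ?_⟩
  intro ρ h0 h1
  have h2 := (abs_le.1 (h ρ h0 (h1.trans_le (min_le_left _ _)))).1
  have h3 : Real.logb 2 ρ < -(3 * C) :=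
    (Real.logb_lt_iff_lt_rpow (by norm_num) h0).2 (h1.trans_le (min_le_right _ _))
  rw [one_div, Real.logb_inv] at h2
  nlinarith
end

section
/- Define f(ρ) = 2ρ·h(ρ) − (1−ρ)²·h((ρ/(1−ρ))²) + 2(1−ρ)·h(ρ/(1−ρ)) − 2·h(ρ) for ρ ∈ (0, 1/2). There exist ξ > 0 and C > 0 such that for all ρ ∈ (0, ξ): |f(ρ) + ρ²/ln 2| ≤ C·ρ³; in particular, there exists ξ′ > 0 such that f(ρ) < 0 for all ρ ∈ (0, ξ′). -/
/-- `f(ρ) = 2ρ·h(ρ) - (1-ρ)²·h((ρ/(1-ρ))²) + 2(1-ρ)·h(ρ/(1-ρ)) - 2·h(ρ)`. -/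
noncomputable def fFun (ρ : ℝ) : ℝ :=
  2 * ρ * binH ρ - (1 - ρ) ^ 2 * binH ((ρ / (1 - ρ)) ^ 2)
    + 2 * (1 - ρ) * binH (ρ / (1 - ρ)) - 2 * binH ρ

lemma fFun_closed (ρ : ℝ) (h0 : 0 < ρ) (h1 : ρ < 1 / 4) :
    fFun ρ = (2 * (1 - ρ) * Real.log (1 - ρ) - (1 - 2 * ρ) * Real.log (1 - 2 * ρ)) / Real.log 2 := by
  have ha : (1 - ρ) ≠ 0 := by linarith
  have hb : (1 - 2 * ρ) ≠ 0 := by linarith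
  have hr : ρ ≠ 0 := h0.ne'
  have hl : Real.log 2 ≠ 0 := (Real.log_pos (by norm_num)).ne'
  have e1 : 1 - ρ / (1 - ρ) = (1 - 2 * ρ) / (1 - ρ) := by field_simp; ring
  have e2 : 1 - (ρ / (1 - ρ)) ^ 2 = (1 - 2 * ρ) / (1 - ρ) ^ 2 := by field_simp; ring
  unfold fFun binH
  rw [e1, e2]
  simp only [Real.logb]
  rw [Real.log_pow, Real.log_div hr ha, Real.log_div hb ha, Real.log_div hb (pow_ne_zero 2 ha),
    Real.log_pow]
  push_cast
  field_simp
  ring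

lemma num_bound (ρ : ℝ) (h0 : 0 < ρ) (h1 : ρ < 1 / 4) :
    |2 * (1 - ρ) * Real.log (1 - ρ) - (1 - 2 * ρ) * Real.log (1 - 2 * ρ) + ρ ^ 2|
      ≤ 23 * ρ ^ 3 := by
  have hA := Real.abs_log_sub_add_sum_range_le (x := ρ) (by rw [abs_of_pos h0]; linarith) 2
  have hB := Real.abs_log_sub_add_sum_range_le (x := 2 * ρ)
    (by rw [abs_of_pos (by linarith)]; linarith) 2
  rw [abs_of_pos h0] at hA
  rw [abs_of_pos (by linarith : 0 < 2 * ρ)] at hB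
  have hp : 0 < ρ ^ 3 := by positivity
  have hA' := hA.trans (show ρ ^ (2 + 1) / (1 - ρ) ≤ 2 * ρ ^ 3 by
    rw [div_le_iff₀ (by linarith)]; norm_num; nlinarith)
  have hB' := hB.trans (show (2 * ρ) ^ (2 + 1) / (1 - 2 * ρ) ≤ 16 * ρ ^ 3 by
    rw [div_le_iff₀ (by linarith)]; ring_nf; nlinarith)
  norm_num [Finset.sum_range_succ] at hA' hB'
  rw [abs_le] at hA' hB' ⊢
  generalize Real.log (1 - ρ) = A at *
  generalize Real.log (1 - 2 * ρ) = B at *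
  have ha : 0 ≤ 1 - ρ := by linarith
  have hb : 0 ≤ 1 - 2 * ρ := by linarith
  have a1 := mul_le_mul_of_nonneg_left hA'.1 ha
  have a2 := mul_le_mul_of_nonneg_left hA'.2 ha
  have b1 := mul_le_mul_of_nonneg_left hB'.1 hb
  have b2 := mul_le_mul_of_nonneg_left hB'.2 hb
  have hq : 0 < ρ * ρ ^ 3 := by positivity
  constructor <;> nlinarith

theorem stmt9 :
    (∃ ξ C : ℝ, 0 < ξ ∧ 0 < C ∧ ∀ ρ : ℝ, 0 < ρ → ρ < ξ →
      |fFun ρ + ρ ^ 2 / Real.log 2| ≤ C * ρ ^ 3) ∧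
    (∃ ξ' : ℝ, 0 < ξ' ∧ ∀ ρ : ℝ, 0 < ρ → ρ < ξ' → fFun ρ < 0) := by
  have hl : 0 < Real.log 2 := Real.log_pos (by norm_num)
  refine ⟨⟨1 / 4, 23 / Real.log 2, by norm_num, by positivity, ?_⟩, 1 / 30, by norm_num, ?_⟩
  · intro ρ h0 h1
    rw [fFun_closed ρ h0 h1, ← add_div, abs_div, abs_of_pos hl, div_mul_eq_mul_div]
    exact div_le_div_of_nonneg_right (num_bound ρ h0 h1) hl.le
  · intro ρ h0 h1
    rw [fFun_closed ρ h0 (by linarith)]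
    apply div_neg_of_neg_of_pos _ hl
    have h := (abs_le.mp (num_bound ρ h0 (by linarith))).2
    have hq : 0 < ρ ^ 2 := by positivity
    nlinarith
end

section
/- For every ρ ∈ (0, 1/3) and every x ∈ (0, 1): 2·log₂(1−x) − 2·log₂(x) + log₂(xρ/(1 − 2ρ + xρ)) ≥ 0 if and only if x ≤ ρ. -/
/-- For `ρ ∈ (0, 1/3)` and `x ∈ (0,1)`:
`2·log₂(1-x) - 2·log₂ x + log₂(xρ/(1-2ρ+xρ)) ≥ 0` if and only if `x ≤ ρ`. -/
theorem stmt11 (ρ x : ℝ) (hρ : 0 < ρ) (hρ' : ρ < 1 / 3) (hx : 0 < x) (hx' : x < 1) :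
    0 ≤ 2 * Real.logb 2 (1 - x) - 2 * Real.logb 2 x
        + Real.logb 2 (x * ρ / (1 - 2 * ρ + x * ρ)) ↔ x ≤ ρ := by
  have h1 : 0 < 1 - x := by linarith
  have hm : 0 < x * ρ := mul_pos hx hρ
  have hD : 0 < 1 - 2 * ρ + x * ρ := by linarith
  have e : 2 * Real.logb 2 (1 - x) - 2 * Real.logb 2 x
        + Real.logb 2 (x * ρ / (1 - 2 * ρ + x * ρ))
      = Real.logb 2 ((1 - x) ^ 2 * (x * ρ)) - Real.logb 2 (x ^ 2 * (1 - 2 * ρ + x * ρ)) := by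
    rw [Real.logb_div hm.ne' hD.ne', Real.logb_mul (pow_pos h1 2).ne' hm.ne',
      Real.logb_mul (pow_pos hx 2).ne' hD.ne', Real.logb_pow, Real.logb_pow]
    push_cast
    ring
  rw [e, sub_nonneg, Real.logb_le_logb (by norm_num) (by positivity) (by positivity)]
  have k : (1 - x) ^ 2 * (x * ρ) - x ^ 2 * (1 - 2 * ρ + x * ρ) = x * (ρ - x) := by ring
  rw [← sub_nonneg, k, mul_nonneg_iff_of_pos_left hx, sub_nonneg]
end

section
/- There exists ξ > 0 such that for every real ρ ∈ (0, ξ) there exists m₀ such that for all natural numbers m ≥ m₀ and all natural numbers r with r = ρ·m, the real-number inequality Σ_{j=0}^{r} choose(r, j)² / choose(m − 2r + j, j) ≤ (choose(m, r) / choose(m − r, r))² holds. -/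
lemma desc_ineq (a r k : ℕ) :
    (a + r) ^ k * a.descFactorial k ≤ a ^ k * (a + r).descFactorial k := by
  induction k with
  | zero => simp
  | succ k ih =>
    rw [Nat.descFactorial_succ, Nat.descFactorial_succ, pow_succ, pow_succ]
    have h : (a + r) * (a - k) ≤ a * (a + r - k) := by
      rcases le_total a k with h | h
      · simp [Nat.sub_eq_zero_of_le h]
      · obtain ⟨c, rfl⟩ := Nat.exists_eq_add_of_le h
        have h1 : k + c - k = c := by omega
        have h2 : k + c + r - k = c + r := by omega
        rw [h1, h2]
        nlinarith [Nat.zero_le (k * r)]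
    calc _ = ((a + r) ^ k * a.descFactorial k) * ((a + r) * (a - k)) := by ring
      _ ≤ (a ^ k * (a + r).descFactorial k) * (a * (a + r - k)) := Nat.mul_le_mul ih h
      _ = _ := by ring

lemma term_ineq (n r j : ℕ) (hn : 0 < n) :
    (Nat.choose r j : ℝ) ^ 2 / (Nat.choose (n + j) j : ℝ) ≤
      ((r : ℝ) / n) ^ j * (Nat.choose r j : ℝ) := by
  have hn' : (0 : ℝ) < n := by exact_mod_cast hn
  have h1 : (Nat.choose r j : ℝ) ≤ (r : ℝ) ^ j / (j.factorial : ℝ) := Nat.choose_le_pow_div j r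
  have h2 : (n : ℝ) ^ j / (j.factorial : ℝ) ≤ (Nat.choose (n + j) j : ℝ) := by
    have h := Nat.pow_le_choose (α := ℝ) j (n + j)
    refine le_trans ?_ h
    have : n + j + 1 - j = n + 1 := by omega
    rw [this]
    gcongr
    push_cast
    linarith
  have hf : (0 : ℝ) < (j.factorial : ℝ) := by exact_mod_cast j.factorial_pos
  have hp : (0 : ℝ) < (n : ℝ) ^ j / (j.factorial : ℝ) := by positivity
  calc (Nat.choose r j : ℝ) ^ 2 / (Nat.choose (n + j) j : ℝ)
      = (Nat.choose r j : ℝ) / (Nat.choose (n + j) j : ℝ) * (Nat.choose r j : ℝ) := by ring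
    _ ≤ ((r : ℝ) ^ j / (j.factorial : ℝ)) / ((n : ℝ) ^ j / (j.factorial : ℝ))
          * (Nat.choose r j : ℝ) := by gcongr
    _ = _ := by
      congr 1
      rw [div_pow]
      field_simp

/-- There exists `ξ > 0` such that for every `ρ ∈ (0, ξ)` there exists `m₀` such that
for all `m ≥ m₀` and all naturals `r` with `r = ρ·m`,
`∑_{j=0}^{r} choose(r,j)² / choose(m - 2r + j, j) ≤ (choose(m,r) / choose(m-r,r))²`
holds in the real numbers. -/
theorem stmt12 :
    ∃ ξ : ℝ, 0 < ξ ∧ ∀ ρ : ℝ, 0 < ρ → ρ < ξ → ∃ m₀ : ℕ, ∀ m : ℕ, m₀ ≤ m →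
      ∀ r : ℕ, (r : ℝ) = ρ * m →
      (∑ j ∈ Finset.range (r + 1),
          (Nat.choose r j : ℝ) ^ 2 / (Nat.choose (m - 2 * r + j) j : ℝ)) ≤
        ((Nat.choose m r : ℝ) / (Nat.choose (m - r) r : ℝ)) ^ 2 := by
  refine ⟨1 / 3, by norm_num, fun ρ hρ hρ' => ⟨1, fun m hm r hr => ?_⟩⟩
  have hm' : (0 : ℝ) < m := by exact_mod_cast hm
  have h3 : 3 * (r : ℝ) < m := by rw [hr]; nlinarith
  have h3' : 3 * r < m := by exact_mod_cast h3
  obtain ⟨n, rfl⟩ : ∃ n, m = n + r + r := ⟨m - 2 * r, by omega⟩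
  have e1 : n + r + r - 2 * r = n := by omega
  have e2 : n + r + r - r = n + r := by omega
  rw [e1, e2]
  have hn : 0 < n := by omega
  have hn' : (0 : ℝ) < n := by exact_mod_cast hn
  have hnr : (r : ℝ) ≤ n := by push_cast at h3; linarith
  have hr0 : (0 : ℝ) ≤ r := Nat.cast_nonneg r
  have hs : (∑ j ∈ Finset.range (r + 1),
          (Nat.choose r j : ℝ) ^ 2 / (Nat.choose (n + j) j : ℝ)) ≤ ((r : ℝ) / n + 1) ^ r := by
    rw [add_pow]
    refine Finset.sum_le_sum fun j _ => ?_
    simpa using term_ineq n r j hn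
  have hd := desc_ineq (n + r) r r
  rw [Nat.descFactorial_eq_factorial_mul_choose, Nat.descFactorial_eq_factorial_mul_choose] at hd
  have hd2 : (n + r + r) ^ r * (n + r).choose r ≤ (n + r) ^ r * (n + r + r).choose r := by
    refine Nat.le_of_mul_le_mul_left ?_ r.factorial_pos
    linarith
  have hd3 : ((n : ℝ) + r + r) ^ r * ((n + r).choose r : ℝ) ≤
      ((n : ℝ) + r) ^ r * ((n + r + r).choose r : ℝ) := by exact_mod_cast hd2
  have hc : (0 : ℝ) < ((n + r).choose r : ℝ) := by
    exact_mod_cast Nat.choose_pos (by omega)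
  have hq : (((n : ℝ) + r + r) / (n + r)) ^ r ≤
      ((n + r + r).choose r : ℝ) / ((n + r).choose r : ℝ) := by
    rw [div_pow, div_le_div_iff₀ (by positivity) hc]
    linarith
  have hb : (r : ℝ) / n + 1 ≤ (((n : ℝ) + r + r) / (n + r)) ^ 2 := by
    rw [div_add_one hn'.ne', div_pow, div_le_div_iff₀ hn' (by positivity)]
    nlinarith [mul_nonneg hr0 (sub_nonneg.2 hnr), mul_nonneg hr0 hr0,
      mul_nonneg (mul_nonneg hr0 hn'.le) (sub_nonneg.2 hnr),
      mul_nonneg (mul_nonneg hr0 (sub_nonneg.2 hnr)) (add_nonneg hn'.le hr0)]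
  calc _ ≤ _ := hs
    _ ≤ ((((n : ℝ) + r + r) / (n + r)) ^ 2) ^ r := by gcongr
    _ = ((((n : ℝ) + r + r) / (n + r)) ^ r) ^ 2 := by rw [← pow_mul, ← pow_mul, mul_comm]
    _ ≤ _ := by gcongr
end

section
/- Fix ρ ∈ (0, 1/2) and define F₁(ρ) = ρ·(1 − ln(ρ/(1−ρ)))/ln 2 − (1−ρ)·h(ρ/(1−ρ)). Then (i) the function ε ↦ [(1−ρ)·h(ερ/(1−ρ)) − ε·(1−ρ)·h(ρ/(1−ρ)) − ε·ρ·log₂(1/ε)]/ε tends to F₁(ρ) as ε → 0⁺, and (ii) there exists ξ > 0 such that F₁(ρ) > 0 for all ρ ∈ (0, ξ). -/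
/-- `F₁(ρ) = ρ·(1 - ln(ρ/(1-ρ)))/ln 2 - (1-ρ)·h(ρ/(1-ρ))`. -/
noncomputable def F1 (ρ : ℝ) : ℝ :=
  ρ * (1 - Real.log (ρ / (1 - ρ))) / Real.log 2 - (1 - ρ) * binH (ρ / (1 - ρ))

/-- For fixed `ρ ∈ (0, 1/2)`: (i) the quotient
`[(1-ρ)·h(ερ/(1-ρ)) - ε·(1-ρ)·h(ρ/(1-ρ)) - ε·ρ·log₂(1/ε)]/ε` tends to `F₁(ρ)` as
`ε → 0⁺`; and (ii) `F₁(ρ') > 0` for all sufficiently small `ρ' > 0`. -/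
theorem stmt13 (ρ : ℝ) (hρ : 0 < ρ) (hρ' : ρ < 1 / 2) :
    Filter.Tendsto (fun ε : ℝ =>
        ((1 - ρ) * binH (ε * ρ / (1 - ρ)) - ε * (1 - ρ) * binH (ρ / (1 - ρ))
          - ε * ρ * Real.logb 2 (1 / ε)) / ε)
      (nhdsWithin 0 (Set.Ioi 0)) (nhds (F1 ρ)) ∧
    ∃ ξ : ℝ, 0 < ξ ∧ ∀ ρ' : ℝ, 0 < ρ' → ρ' < ξ → 0 < F1 ρ' := by
  have hl2 : 0 < Real.log 2 := Real.log_pos (by norm_num)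
  constructor
  · have h1 : (0 : ℝ) < 1 - ρ := by linarith
    obtain ⟨x, hx⟩ : ∃ x, x = ρ / (1 - ρ) := ⟨_, rfl⟩
    have hx0 : 0 < x := by rw [hx]; positivity
    have hρx : ρ = (1 - ρ) * x := by rw [hx]; field_simp
    have hd : HasDerivAt (fun e : ℝ => (1 - e * x) * Real.log (1 - e * x)) (-x) 0 := by
      have ha : HasDerivAt (fun e : ℝ => 1 - e * x) (-x) 0 := by
        simpa using ((hasDerivAt_id (0 : ℝ)).mul_const x).const_sub 1
      have hb := ha.mul (ha.log (by simp))
      have hc : -x * Real.log (1 - 0 * x) + (1 - 0 * x) * (-x / (1 - 0 * x)) = -x := by simp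
      exact hc ▸ hb
    have ht : Filter.Tendsto (fun e : ℝ => e⁻¹ * ((1 - e * x) * Real.log (1 - e * x)))
        (nhdsWithin 0 (Set.Ioi 0)) (nhds (-x)) := by
      have := hd.tendsto_slope_zero_right
      simpa using this
    have hF : F1 ρ = (-ρ * Real.log x - (1 - ρ) * (-x)) / Real.log 2
        - (1 - ρ) * binH x := by
      unfold F1
      rw [← hx]
      have : (1 - ρ) * (-x) = -ρ := by linarith
      rw [this]; ring
    rw [hF]
    have ht2 := (((ht.const_mul (1 - ρ)).const_sub (-ρ * Real.log x)).div_const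
      (Real.log 2)).sub_const ((1 - ρ) * binH x)
    refine ht2.congr' ?_
    filter_upwards [self_mem_nhdsWithin] with e he
    have he : 0 < e := he
    rw [mul_div_assoc, ← hx]
    generalize binH x = B
    unfold binH
    simp only [Real.logb]
    rw [Real.log_mul he.ne' hx0.ne', one_div, Real.log_inv]
    generalize Real.log (1 - e * x) = L
    generalize Real.log x = M
    generalize Real.log e = N
    field_simp
    linear_combination (-e * M - e * N) * hρx + e * N * 0
  · refine ⟨1 / 2, by norm_num, fun r h0 hr => ?_⟩
    have h1 : (0 : ℝ) < 1 - r := by linarith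
    have h2 : (0 : ℝ) < 1 - 2 * r := by linarith
    have hy : 1 - r / (1 - r) = (1 - 2 * r) / (1 - r) := by field_simp; ring
    have hF : F1 r = (r - (1 - 2 * r) * Real.log ((1 - r) / (1 - 2 * r))) / Real.log 2 := by
      unfold F1 binH
      simp only [Real.logb]
      rw [hy, ← inv_div (1 - 2 * r) (1 - r), Real.log_inv]
      generalize Real.log ((1 - 2 * r) / (1 - r)) = L
      generalize Real.log (r / (1 - r)) = M
      field_simp
      ring
    rw [hF]
    apply div_pos _ hl2
    have hlt := Real.log_lt_sub_one_of_pos (x := (1 - r) / (1 - 2 * r)) (by positivity)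
      (by rw [ne_eq, div_eq_one_iff_eq h2.ne']; intro h; linarith)
    have := mul_lt_mul_of_pos_left hlt h2
    have h3 : (1 - 2 * r) * ((1 - r) / (1 - 2 * r) - 1) = r := by field_simp; ring
    linarith
end

section
/- Fix ρ ∈ (0, 1/2). Then (i) the function ε ↦ [(1−2ρ)·h(ερ/(1−2ρ)) − 2ρε − ε·ρ·log₂(1/ε)]/ε tends to ρ·(log₂ e + log₂((1−2ρ)/ρ) − 2) as ε → 0⁺, and (ii) there exists ξ > 0 such that ρ·(log₂ e + log₂((1−2ρ)/ρ) − 2) > 0 for all ρ ∈ (0, ξ). -/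
/-- For fixed `ρ ∈ (0, 1/2)`: (i) the quotient
`[(1-2ρ)·h(ερ/(1-2ρ)) - 2ρε - ε·ρ·log₂(1/ε)]/ε` tends to
`ρ·(log₂ e + log₂((1-2ρ)/ρ) - 2)` as `ε → 0⁺`; and (ii) this limit value is positive
for all sufficiently small `ρ' > 0`. -/
theorem stmt14 (ρ : ℝ) (hρ : 0 < ρ) (hρ' : ρ < 1 / 2) :
    Filter.Tendsto (fun ε : ℝ =>
        ((1 - 2 * ρ) * binH (ε * ρ / (1 - 2 * ρ)) - 2 * ρ * ε
          - ε * ρ * Real.logb 2 (1 / ε)) / ε)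
      (nhdsWithin 0 (Set.Ioi 0))
      (nhds (ρ * (Real.logb 2 (Real.exp 1) + Real.logb 2 ((1 - 2 * ρ) / ρ) - 2))) ∧
    ∃ ξ : ℝ, 0 < ξ ∧ ∀ ρ' : ℝ, 0 < ρ' → ρ' < ξ →
      0 < ρ' * (Real.logb 2 (Real.exp 1) + Real.logb 2 ((1 - 2 * ρ') / ρ') - 2) := by
  constructor
  · have hd : 0 < 1 - 2 * ρ := by linarith
    obtain ⟨c, hc⟩ : ∃ c, c = ρ / (1 - 2 * ρ) := ⟨_, rfl⟩
    have hcpos : 0 < c := by rw [hc]; positivity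
    have hl2 : Real.log 2 ≠ 0 := (Real.log_pos (by norm_num)).ne'
    have hcd : (1 - 2 * ρ) * c = ρ := by rw [hc]; field_simp
    have hder : HasDerivAt (fun ε : ℝ => (1 - c * ε) * Real.log (1 - c * ε)) (-c) 0 := by
      have h1 : HasDerivAt (fun ε : ℝ => 1 - c * ε) (-c) 0 := by
        simpa using ((hasDerivAt_id (0 : ℝ)).const_mul c).const_sub 1
      have h2 := h1.mul (h1.log (by simp))
      refine HasDerivAt.congr_deriv (f := fun ε : ℝ => (1 - c * ε) * Real.log (1 - c * ε)) h2 ?_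
      simp
    have hs := hder.tendsto_slope_zero_right
    have hs2 := (hs.const_mul (-(1 - 2 * ρ) / Real.log 2)).const_add (-ρ * Real.logb 2 c - 2 * ρ)
    have hlim : -ρ * Real.logb 2 c - 2 * ρ + -(1 - 2 * ρ) / Real.log 2 * -c
        = ρ * (Real.logb 2 (Real.exp 1) + Real.logb 2 ((1 - 2 * ρ) / ρ) - 2) := by
      have h3 : (1 - 2 * ρ) / ρ = c⁻¹ := by rw [hc, inv_div]
      have h4 : -(1 - 2 * ρ) / Real.log 2 * -c = ρ / Real.log 2 := by
        linear_combination hcd / Real.log 2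
      rw [h3, h4, Real.logb_inv]
      simp only [Real.logb, Real.log_exp]
      ring
    rw [hlim] at hs2
    refine hs2.congr' ?_
    filter_upwards [self_mem_nhdsWithin] with ε hε
    have hε0 : ε ≠ 0 := ne_of_gt hε
    have hx : ε * ρ / (1 - 2 * ρ) = c * ε := by rw [hc]; ring
    rw [hx, binH, Real.logb_mul hcpos.ne' hε0, one_div, Real.logb_inv]
    have h5 : (1 - 2 * ρ) * (-(c * ε) * (Real.logb 2 c + Real.logb 2 ε)
        - (1 - c * ε) * Real.logb 2 (1 - c * ε)) =
        -(ρ * ε) * (Real.logb 2 c + Real.logb 2 ε)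
        - (1 - 2 * ρ) * ((1 - c * ε) * Real.logb 2 (1 - c * ε)) := by
      linear_combination (-ε * (Real.logb 2 c + Real.logb 2 ε)) * hcd
    rw [h5]
    simp only [Real.logb, zero_add, mul_zero, sub_zero, Real.log_one, smul_eq_mul]
    field_simp
    ring
  · refine ⟨1 / 6, by norm_num, fun r hr hr' => mul_pos hr ?_⟩
    have h1 : 0 < Real.logb 2 (Real.exp 1) :=
      Real.logb_pos (by norm_num) (Real.one_lt_exp_iff.mpr one_pos)
    have h4 : (4 : ℝ) < (1 - 2 * r) / r := by
      rw [lt_div_iff₀ hr]; linarith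
    have h2 : 2 < Real.logb 2 ((1 - 2 * r) / r) := by
      rw [Real.lt_logb_iff_rpow_lt (by norm_num) (by linarith)]
      norm_num
      exact h4
    linarith
end

section
/- Fix ρ ∈ (0, 1/8) and define f₁(y) = 2·(y−2)·ρ·(log₂(y−2) − 1) + (1 − 4ρ + yρ)·h(ρ·(y−2)/(1 − 4ρ + yρ)) for y ∈ (2, 3). Then f₁(y) tends to 0 as y → 2⁺, and there exists δ₁ > 0 such that f₁(y) ≤ 0 for all y ∈ (2, 2 + δ₁]. -/
theorem binH_eq (x : ℝ) : binH x = Real.binEntropy x / Real.log 2 := by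
  rw [binH, Real.binEntropy, Real.logb, Real.logb, Real.log_inv, Real.log_inv]
  ring

/-- For fixed `ρ ∈ (0, 1/8)`, the function
`f₁(y) = 2(y-2)ρ(log₂(y-2) - 1) + (1 - 4ρ + yρ)·h(ρ(y-2)/(1 - 4ρ + yρ))`
tends to `0` as `y → 2⁺`, and `f₁(y) ≤ 0` on `(2, 2 + δ₁]` (within `(2,3)`)
for some `δ₁ > 0`. -/
theorem stmt16 (ρ : ℝ) (hρ : 0 < ρ) (hρ' : ρ < 1 / 8) :
    Filter.Tendsto (fun y : ℝ =>
        2 * (y - 2) * ρ * (Real.logb 2 (y - 2) - 1)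
          + (1 - 4 * ρ + y * ρ) * binH (ρ * (y - 2) / (1 - 4 * ρ + y * ρ)))
      (nhdsWithin 2 (Set.Ioi 2)) (nhds 0) ∧
    ∃ δ₁ : ℝ, 0 < δ₁ ∧ ∀ y : ℝ, 2 < y → y ≤ 2 + δ₁ → y < 3 →
      2 * (y - 2) * ρ * (Real.logb 2 (y - 2) - 1)
        + (1 - 4 * ρ + y * ρ) * binH (ρ * (y - 2) / (1 - 4 * ρ + y * ρ)) ≤ 0 := by
  have hl2 : 0 < Real.log 2 := Real.log_pos (by norm_num)
  constructor
  · have key : ContinuousAt (fun y : ℝ =>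
        2 * ρ / Real.log 2 * ((y - 2) * Real.log (y - 2)) - 2 * (y - 2) * ρ
          + (1 - 4 * ρ + y * ρ) *
            (Real.binEntropy (ρ * (y - 2) / (1 - 4 * ρ + y * ρ)) / Real.log 2)) 2 := by
      have h1 : ContinuousAt (fun y : ℝ => (y - 2) * Real.log (y - 2)) 2 :=
        (Real.continuous_mul_log.comp (continuous_id.sub continuous_const)).continuousAt
      have h2 : ContinuousAt (fun y : ℝ => ρ * (y - 2) / (1 - 4 * ρ + y * ρ)) 2 := by
        apply ContinuousAt.div
        · fun_prop
        · fun_prop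
        · linarith
      have h3 : ContinuousAt
          (fun y : ℝ => Real.binEntropy (ρ * (y - 2) / (1 - 4 * ρ + y * ρ))) 2 :=
        ContinuousAt.comp (g := Real.binEntropy) Real.binEntropy_continuous.continuousAt h2
      have h4 : ContinuousAt (fun y : ℝ => 1 - 4 * ρ + y * ρ) 2 := by fun_prop
      have h5 : ContinuousAt (fun y : ℝ => 2 * (y - 2) * ρ) 2 := by fun_prop
      exact ((continuousAt_const.mul h1).sub h5).add (h4.mul (h3.div_const _))
    have key2 := key.tendsto.mono_left (nhdsWithin_le_nhds (s := Set.Ioi 2))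
    simp only [sub_self, mul_zero, zero_mul, zero_div, Real.binEntropy_zero, add_zero] at key2
    refine key2.congr (fun y => ?_)
    rw [binH_eq, Real.logb]
    ring
  · refine ⟨ρ * Real.exp (-1), by positivity, fun y hy hyd hy3 => ?_⟩
    obtain ⟨t, rfl⟩ : ∃ t, y = 2 + t := ⟨y - 2, by ring⟩
    have ht : 0 < t := by linarith
    have ht1 : t < 1 := by linarith
    have hlt : Real.log t ≤ Real.log ρ - 1 := by
      have := Real.log_le_log ht (show t ≤ ρ * Real.exp (-1) by linarith)
      rw [Real.log_mul hρ.ne' (Real.exp_pos _).ne', Real.log_exp] at this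
      linarith
    have ha : 0 < ρ * t := mul_pos hρ ht
    have hB : 0 < 1 - 2 * ρ := by linarith
    have hA' : 1 - 4 * ρ + (2 + t) * ρ = (1 - 2 * ρ) + ρ * t := by ring
    have hyt : 2 + t - 2 = t := by ring
    rw [hA', hyt]
    obtain ⟨B, hBd⟩ : ∃ B, B = 1 - 2 * ρ := ⟨_, rfl⟩
    rw [← hBd] at hB ⊢
    have hA : 0 < B + ρ * t := by positivity
    have hAle : B + ρ * t ≤ 1 := by nlinarith
    have hlA : Real.log (B + ρ * t) ≤ 0 := Real.log_nonpos hA.le hAle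
    have h1 : 1 - ρ * t / (B + ρ * t) = B / (B + ρ * t) := by
      field_simp
      ring
    have h2 : B * (Real.log (B + ρ * t) - Real.log B) ≤ ρ * t := by
      have h := Real.log_le_sub_one_of_pos (div_pos hA hB)
      rw [Real.log_div hA.ne' hB.ne'] at h
      have h' := mul_le_mul_of_nonneg_left h hB.le
      have e : B * ((B + ρ * t) / B - 1) = ρ * t := by
        field_simp
        ring
      linarith
    have e : 2 * t * ρ * (Real.logb 2 t - 1) + (B + ρ * t) * binH (ρ * t / (B + ρ * t))
        = (2 * (ρ * t) * (Real.log t - Real.log 2)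
          + ρ * t * (Real.log (B + ρ * t) - Real.log ρ - Real.log t)
          + B * (Real.log (B + ρ * t) - Real.log B)) / Real.log 2 := by
      rw [binH, h1, Real.logb, Real.logb, Real.logb, Real.log_div ha.ne' hA.ne',
        Real.log_div hB.ne' hA.ne', Real.log_mul hρ.ne' ht.ne']
      generalize Real.log (B + ρ * t) = L
      field_simp
      ring
    rw [e]
    apply div_nonpos_of_nonpos_of_nonneg _ hl2.le
    have h3 : ρ * t * (Real.log t - 2 * Real.log 2 + Real.log (B + ρ * t) - Real.log ρ + 1) ≤ 0 :=
      mul_nonpos_of_nonneg_of_nonpos ha.le (by linarith)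
    linarith
end

section
/- Fix ρ ∈ (0, 1/8) and define f₂(x) = 2ρ·(2−x)·(log₂(2−x) − 1) + (1 − ρx)·h(ρ·(2−x)/(1 − ρx)) for x ∈ (1, 2). Then f₂(x) tends to 0 as x → 2⁻, and there exists δ₂ > 0 such that f₂(x) ≤ 0 for all x ∈ [2 − δ₂, 2). -/
/-- For fixed `ρ ∈ (0, 1/8)`, the function
`f₂(x) = 2ρ(2-x)(log₂(2-x) - 1) + (1 - ρx)·h(ρ(2-x)/(1 - ρx))`
tends to `0` as `x → 2⁻`, and `f₂(x) ≤ 0` on `[2 - δ₂, 2)` (within `(1,2)`)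
for some `δ₂ > 0`. -/
theorem stmt17 (ρ : ℝ) (hρ : 0 < ρ) (hρ' : ρ < 1 / 8) :
    Filter.Tendsto (fun x : ℝ =>
        2 * ρ * (2 - x) * (Real.logb 2 (2 - x) - 1)
          + (1 - ρ * x) * binH (ρ * (2 - x) / (1 - ρ * x)))
      (nhdsWithin 2 (Set.Iio 2)) (nhds 0) ∧
    ∃ δ₂ : ℝ, 0 < δ₂ ∧ ∀ x : ℝ, 2 - δ₂ ≤ x → x < 2 → 1 < x →
      2 * ρ * (2 - x) * (Real.logb 2 (2 - x) - 1)
        + (1 - ρ * x) * binH (ρ * (2 - x) / (1 - ρ * x)) ≤ 0 := by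
  constructor
  · have hc : ContinuousAt (fun x : ℝ =>
        2 * ρ * ((2 - x) * Real.log (2 - x)) / Real.log 2 - 2 * ρ * (2 - x)
          + (1 - ρ * x) * (Real.binEntropy (ρ * (2 - x) / (1 - ρ * x)) / Real.log 2)) 2 := by
      have h1 : Continuous (fun x : ℝ => (2 - x) * Real.log (2 - x)) :=
        Real.continuous_mul_log.comp (continuous_const.sub continuous_id)
      have h2 : ContinuousAt (fun x : ℝ => ρ * (2 - x) / (1 - ρ * x)) 2 := by
        apply ContinuousAt.div
        · fun_prop
        · fun_prop
        · intro h; linarith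
      have h3 : ContinuousAt (fun x : ℝ => Real.binEntropy (ρ * (2 - x) / (1 - ρ * x))) 2 :=
        Real.binEntropy_continuous.continuousAt.comp h2
      have h4 := h1.continuousAt (x := (2 : ℝ))
      exact (((continuousAt_const.mul h4).div_const _).sub (by fun_prop)).add
        (ContinuousAt.mul (by fun_prop) (h3.div_const _))
    have ht := hc.tendsto.mono_left (nhdsWithin_le_nhds (s := Set.Iio (2 : ℝ)))
    simp only [sub_self, zero_mul, mul_zero, zero_div, Real.binEntropy_zero, add_zero] at ht
    refine ht.congr ?_
    intro x
    rw [binH_eq, Real.logb]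
    ring
  · refine ⟨ρ * Real.exp (-1), by positivity, ?_⟩
    intro x hx hx2 hx1
    obtain ⟨t, rfl⟩ : ∃ t, x = 2 - t := ⟨2 - x, by ring⟩
    have ht : 0 < t := by linarith
    have ht1 : t < 1 := by linarith
    have hte : t ≤ ρ * Real.exp (-1) := by linarith
    rw [binH_eq, Real.binEntropy_eq_negMulLog_add_negMulLog_one_sub, Real.logb,
      show 2 - (2 - t) = t by ring]
    simp only [Real.negMulLog]
    have hρt : 0 < ρ * t := by positivity
    have hρt1 : ρ * t < ρ := by nlinarith
    obtain ⟨N, hN⟩ : ∃ N, N = 1 - ρ * (2 - t) := ⟨_, rfl⟩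
    rw [← hN]
    have hN0 : 0 < N := by rw [hN]; linarith
    have hN1 : N ≤ 1 := by rw [hN]; linarith
    have hNt : 0 < N - ρ * t := by rw [hN]; linarith
    have hl2 : 0 < Real.log 2 := Real.log_pos (by norm_num)
    have hlt : Real.log t ≤ Real.log ρ - 1 := by
      have := Real.log_le_log ht hte
      rw [Real.log_mul hρ.ne' (Real.exp_pos _).ne', Real.log_exp] at this
      linarith
    have hlN : Real.log N ≤ 0 := Real.log_nonpos hN0.le hN1
    have hly : Real.log (ρ * t / N) = Real.log ρ + Real.log t - Real.log N := by
      rw [Real.log_div hρt.ne' hN0.ne', Real.log_mul hρ.ne' ht.ne']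
    have h1y : 1 - ρ * t / N = (N - ρ * t) / N := by field_simp
    have hent : -(N - ρ * t) * Real.log ((N - ρ * t) / N) ≤ ρ * t := by
      have h := Real.one_sub_inv_le_log_of_pos (div_pos hNt hN0)
      have h' := mul_le_mul_of_nonneg_left h hNt.le
      have e : (N - ρ * t) * (1 - ((N - ρ * t) / N)⁻¹) = -(ρ * t) := by
        field_simp
        ring
      linarith
    rw [h1y, hly]
    generalize Real.log ((N - ρ * t) / N) = L at *
    have key : 2 * ρ * t * (Real.log t / Real.log 2 - 1) +
        N * ((-(ρ * t / N) * (Real.log ρ + Real.log t - Real.log N) +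
          -((N - ρ * t) / N) * L) / Real.log 2)
        = (ρ * t * (Real.log t - 2 * Real.log 2 - Real.log ρ + Real.log N)
          + -(N - ρ * t) * L) / Real.log 2 := by
      field_simp
      ring
    rw [key]
    apply div_nonpos_of_nonpos_of_nonneg _ hl2.le
    have : ρ * t * (Real.log t - 2 * Real.log 2 - Real.log ρ + Real.log N) ≤ ρ * t * (-1) :=
      mul_le_mul_of_nonneg_left (by linarith) hρt.le
    linarith
end
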